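/- Consider the sparse linear regression model with all quantities k=k_n, p=p_n, τ=τ_n, σ=σ_n depending on n and asymptotics as n→∞, and set μ = τ/σ. Assume k/p → 0 and (k·log p)/n → 0. If μ → 0 (the low-SNR Regime I), then the minimax risk over the SNR-aware parameter space satisfies R(Θ(k,τ), σ) / (k τ²) → 1. -/

import Mathlib

open MeasureTheory ProbabilityTheory Filter
open scoped NNReal ENNReal

noncomputable section

/-- Joint law of the data: a design matrix with i.i.d. `N(0, (1/n) I_p)` rows
(entries i.i.d. `N(0, 1/n)`) and an independent noise vector with i.i.d. `N(0,1)` entries. -/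
def model (n p : ℕ) : Measure ((Fin n → Fin p → ℝ) × (Fin n → ℝ)) :=
  (Measure.pi fun _ : Fin n => Measure.pi fun _ : Fin p => gaussianReal 0 (n : ℝ≥0)⁻¹).prod
    (Measure.pi fun _ : Fin n => gaussianReal 0 1)

/-- Expected squared-error risk `E_β ‖est(X, Xβ + σ z) − β‖₂²` of an estimator `est`
under the true parameter `β` and noise level `σ`. -/
def risk (n p : ℕ) (σ : ℝ)
    (est : (Fin n → Fin p → ℝ) × (Fin n → ℝ) → Fin p → ℝ) (β : Fin p → ℝ) : ℝ≥0∞ :=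
  ∫⁻ ω, ENNReal.ofReal
      (∑ j, (est (ω.1, fun i => (∑ l, ω.1 i l * β l) + σ * ω.2 i) j - β j) ^ 2) ∂ model n p

/-- The `ℓ₀` norm: number of nonzero coordinates. -/
def l0norm {p : ℕ} (β : Fin p → ℝ) : ℕ := (Finset.univ.filter fun j => β j ≠ 0).card

/-- The SNR-aware sparse parameter space `Θ(k, τ)`. -/
def Theta (p k : ℕ) (τ : ℝ) : Set (Fin p → ℝ) :=
  {β | l0norm β ≤ k ∧ ∑ j, β j ^ 2 ≤ k * τ ^ 2}

/-- The minimax risk `R(Θ(k,τ), σ)`: infimum over measurable estimators of the supremum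
risk over `Θ(k,τ)`. -/
def minimaxRisk (n p k : ℕ) (τ σ : ℝ) : ℝ≥0∞ :=
  ⨅ (est : (Fin n → Fin p → ℝ) × (Fin n → ℝ) → Fin p → ℝ) (_ : Measurable est),
    ⨆ β ∈ Theta p k τ, risk n p σ est β

/-- On a finite product of probability spaces, the integral of a product of functions of the
single coordinates is the product of the integrals. -/
lemma lintegral_pi_prod_eq_prod {ι : Type*} [Fintype ι] {α : ι → Type*}
    [∀ i, MeasurableSpace (α i)] (μ : ∀ i, Measure (α i)) [∀ i, IsProbabilityMeasure (μ i)]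
    {f : ∀ i, α i → ℝ≥0∞} (hf : ∀ i, Measurable (f i)) :
    ∫⁻ x, ∏ i, f i (x i) ∂Measure.pi μ = ∏ i, ∫⁻ y, f i y ∂μ i := by
  have hind : iIndepFun (fun i (x : ∀ i, α i) => f i (x i)) (Measure.pi μ) :=
    iIndepFun_pi (X := f) fun i => (hf i).aemeasurable
  have h := lintegral_prod_eq_prod_lintegral_of_indepFun Finset.univ
    (fun i (x : ∀ i, α i) => f i (x i)) hind (fun i => (hf i).comp (measurable_pi_apply i))
  rw [h]
  exact Finset.prod_congr rfl fun i _ => (measurePreserving_eval μ i).lintegral_comp (hf i)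

lemma pi_withDensity_eq {ι : Type*} [Fintype ι] {α : ι → Type*}
    [∀ i, MeasurableSpace (α i)] (μ ν : ∀ i, Measure (α i)) [∀ i, IsProbabilityMeasure (μ i)]
    [∀ i, IsProbabilityMeasure (ν i)]
    {f : ∀ i, α i → ℝ≥0∞} (hf : ∀ i, Measurable (f i)) (h : ∀ i, ν i = (μ i).withDensity (f i)) :
    Measure.pi ν = (Measure.pi μ).withDensity fun x => ∏ i, f i (x i) := by
  refine Measure.pi_eq fun s hs => ?_
  rw [withDensity_apply _ (MeasurableSet.univ_pi hs),
    ← lintegral_indicator (MeasurableSet.univ_pi hs)]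
  have hprod : (Set.univ.pi s).indicator (fun x => ∏ i, f i (x i))
      = fun x => ∏ i, (s i).indicator (f i) (x i) := by
    funext x
    by_cases hx : x ∈ Set.univ.pi s
    · rw [Set.indicator_of_mem hx]
      exact Finset.prod_congr rfl fun i _ => (Set.indicator_of_mem (hx i trivial) _).symm
    · rw [Set.indicator_of_notMem hx]
      obtain ⟨i, hi⟩ : ∃ i, x i ∉ s i := by simpa [Set.mem_pi] using hx
      exact (Finset.prod_eq_zero (Finset.mem_univ i) (Set.indicator_of_notMem hi _)).symm
  rw [hprod, lintegral_pi_prod_eq_prod μ fun i => (hf i).indicator (hs i)]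
  refine Finset.prod_congr rfl fun i _ => ?_
  rw [lintegral_indicator (hs i), h i, withDensity_apply _ (hs i)]

lemma gaussianReal_one_eq_withDensity (v : ℝ) :
    gaussianReal v 1 = (gaussianReal 0 1).withDensity
      fun x => ENNReal.ofReal (Real.exp (v * x - v ^ 2 / 2)) := by
  rw [gaussianReal_of_var_ne_zero _ one_ne_zero, gaussianReal_of_var_ne_zero _ one_ne_zero,
    ← withDensity_mul _ (measurable_gaussianPDF _ _) (by fun_prop)]
  congr 1
  funext x
  simp only [Pi.mul_apply, gaussianPDF]
  rw [← ENNReal.ofReal_mul (gaussianPDFReal_nonneg _ _ _)]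
  congr 1
  simp only [gaussianPDFReal]
  conv_rhs => rw [mul_assoc, ← Real.exp_add]
  congr 2
  simp only [NNReal.coe_one]
  ring

/-- Likelihood ratio of `N(v, I)` with respect to `N(0, I)`. -/
def shiftRatio {n : ℕ} (v w : Fin n → ℝ) : ℝ := Real.exp (∑ i, (v i * w i - v i ^ 2 / 2))

lemma measurable_shiftRatio {n : ℕ} (v : Fin n → ℝ) : Measurable (shiftRatio v) := by
  unfold shiftRatio
  fun_prop

lemma lintegral_add_stdGaussian {n : ℕ} (v : Fin n → ℝ) {g : (Fin n → ℝ) → ℝ≥0∞}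
    (hg : Measurable g) :
    ∫⁻ z, g (v + z) ∂(Measure.pi fun _ : Fin n => gaussianReal 0 1)
      = ∫⁻ w, ENNReal.ofReal (shiftRatio v w) * g w
          ∂(Measure.pi fun _ : Fin n => gaussianReal 0 1) := by
  have hmap : (Measure.pi fun _ : Fin n => gaussianReal 0 1).map (fun z => v + z)
      = Measure.pi fun i : Fin n => gaussianReal (v i) 1 := by
    have := Measure.pi_map_pi (μ := fun _ : Fin n => gaussianReal 0 1)
      (f := fun i z => v i + z) (fun i => by fun_prop)
    simp only [gaussianReal_map_const_add, zero_add] at this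
    exact this
  have hden := pi_withDensity_eq (fun _ : Fin n => gaussianReal 0 1)
    (fun i : Fin n => gaussianReal (v i) 1) (fun i => by fun_prop)
    (fun i => gaussianReal_one_eq_withDensity (v i))
  rw [← lintegral_map hg (by fun_prop : Measurable fun z : Fin n → ℝ => v + z), hmap, hden,
    lintegral_withDensity_eq_lintegral_mul _ (by fun_prop) hg]
  refine lintegral_congr fun w => ?_
  simp only [Pi.mul_apply, shiftRatio]
  rw [Real.exp_sum, ENNReal.ofReal_prod_of_nonneg fun i _ => (Real.exp_pos _).le]

lemma lintegral_shiftRatio {n : ℕ} (v : Fin n → ℝ) :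
    ∫⁻ w, ENNReal.ofReal (shiftRatio v w) ∂(Measure.pi fun _ : Fin n => gaussianReal 0 1) = 1 := by
  have h := lintegral_add_stdGaussian v (g := fun _ => 1) measurable_const
  simpa using h.symm

lemma shiftRatio_sq_div {n : ℕ} (u v w : Fin n → ℝ) :
    shiftRatio u w ^ 2 / shiftRatio v w
      = Real.exp (∑ i, (u i - v i) ^ 2) * shiftRatio (fun i => 2 * u i - v i) w := by
  simp only [shiftRatio]
  rw [← Real.exp_nat_mul, ← Real.exp_sub, ← Real.exp_add, Finset.mul_sum,
    ← Finset.sum_sub_distrib, ← Finset.sum_add_distrib]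
  congr 1
  refine Finset.sum_congr rfl fun i _ => ?_
  push_cast
  ring

/-- The `χ²`-type integral of two shifted standard Gaussians. -/
lemma lintegral_shiftRatio_sq_div {n : ℕ} (u v : Fin n → ℝ) :
    ∫⁻ w, ENNReal.ofReal (shiftRatio u w ^ 2 / shiftRatio v w)
        ∂(Measure.pi fun _ : Fin n => gaussianReal 0 1)
      = ENNReal.ofReal (Real.exp (∑ i, (u i - v i) ^ 2)) := by
  simp only [shiftRatio_sq_div, ENNReal.ofReal_mul (Real.exp_pos _).le]
  rw [lintegral_const_mul _ (measurable_shiftRatio _).ennreal_ofReal, lintegral_shiftRatio, mul_one]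

/-- Posterior loss of any action when one of `m` candidate spikes of height `t` has been planted with
likelihoods `q`. -/
lemma sum_mul_spike_loss_lower_bound {m : ℕ} (hm : 0 < m) (t : ℝ) (q a : Fin m → ℝ)
    (hq : ∀ j, 0 < q j) :
    t ^ 2 * ∑ j, q j ≤ ∑ j, q j * ∑ i, (a i - if i = j then t else 0) ^ 2
      + t ^ 2 / m ^ 2 * ∑ j, ∑ l, q j ^ 2 / q l := by
  have : NeZero m := ⟨hm.ne'⟩
  have hm' : (0 : ℝ) < m := Nat.cast_pos.mpr hm
  have hS : 0 < ∑ j, q j := Finset.sum_pos (fun j _ => hq j) Finset.univ_nonempty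
  set S := ∑ j, q j with hSdef
  set H := ∑ l, (q l)⁻¹ with hHdef
  have hSH : (m : ℝ) ^ 2 ≤ S * H := by
    have h := Finset.sum_sq_le_sum_mul_sum_of_sq_le_mul (Finset.univ : Finset (Fin m))
      (r := fun _ => (1 : ℝ)) (f := q) (g := fun l => (q l)⁻¹) (fun j _ => (hq j).le)
      (fun j _ => (inv_pos.mpr (hq j)).le) (fun j _ => by
        rw [mul_inv_cancel₀ (hq j).ne', one_pow])
    simpa using h
  have hloss : ∑ j, q j * ∑ i, (a i - if i = j then t else 0) ^ 2
      = ∑ i, (S * a i ^ 2 - 2 * t * a i * q i + t ^ 2 * q i) := by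
    simp only [Finset.mul_sum]
    rw [Finset.sum_comm]
    refine Finset.sum_congr rfl fun i _ => ?_
    have : ∀ j, q j * (a i - if i = j then t else 0) ^ 2
        = q j * a i ^ 2 + if i = j then q j * (t ^ 2 - 2 * t * a i) else 0 := by
      intro j
      split_ifs <;> ring
    simp only [this, Finset.sum_add_distrib, Finset.sum_ite_eq, Finset.mem_univ, if_true,
      ← Finset.sum_mul]
    ring
  have hchi : ∑ j, ∑ l, q j ^ 2 / q l = ∑ j, q j ^ 2 * H := by
    simp only [div_eq_mul_inv, ← Finset.mul_sum, hHdef]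
  rw [hloss, hchi, hSdef, Finset.mul_sum, Finset.mul_sum, ← Finset.sum_add_distrib]
  refine Finset.sum_le_sum fun i _ => ?_
  have hH : 1 / S ≤ H / m ^ 2 := by
    rw [div_le_div_iff₀ hS (by positivity)]
    linarith
  have h1 : t ^ 2 * q i ^ 2 * (1 / S) ≤ t ^ 2 / m ^ 2 * (q i ^ 2 * H) := by
    calc t ^ 2 * q i ^ 2 * (1 / S) ≤ t ^ 2 * q i ^ 2 * (H / m ^ 2) := by gcongr
      _ = _ := by ring
  have h2 : S * a i ^ 2 - 2 * t * a i * q i + t ^ 2 * q i ^ 2 * (1 / S)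
      = (S * a i - t * q i) ^ 2 / S := by
    field_simp
    ring
  have h3 : 0 ≤ (S * a i - t * q i) ^ 2 / S := by positivity
  linarith

/-- Bayes risk lower bound for locating one spike of height `t` among `m` candidate Gaussian
means `v j`, in terms of the pairwise distances of the means. -/
lemma spike_bayes_risk_lower_bound {n m : ℕ} (hm : 0 < m) (t : ℝ) (v : Fin m → Fin n → ℝ)
    (a : (Fin n → ℝ) → Fin m → ℝ) (ha : Measurable a) :
    ENNReal.ofReal (t ^ 2 * m) ≤
      ∑ j, ∫⁻ z, ENNReal.ofReal (∑ i, (a (v j + z) i - if i = j then t else 0) ^ 2)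
          ∂(Measure.pi fun _ : Fin n => gaussianReal 0 1)
        + ENNReal.ofReal (t ^ 2 / m ^ 2) *
          ∑ j, ∑ l, ENNReal.ofReal (Real.exp (∑ i, (v j i - v l i) ^ 2)) := by
  set γ := Measure.pi fun _ : Fin n => gaussianReal 0 1 with hγ
  have hai : ∀ i, Measurable fun w => a w i := fun i => (measurable_pi_apply i).comp ha
  have hloss : ∀ j, Measurable fun w =>
      ENNReal.ofReal (∑ i, (a w i - if i = j then t else 0) ^ 2) := by
    intro j
    fun_prop
  have hr := fun u : Fin n → ℝ => measurable_shiftRatio u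
  have hpos : ∀ u w : Fin n → ℝ, 0 < shiftRatio u w := fun u w => Real.exp_pos _
  have key : ∀ w, ENNReal.ofReal (t ^ 2) * ∑ j, ENNReal.ofReal (shiftRatio (v j) w) ≤
      ∑ j, ENNReal.ofReal (shiftRatio (v j) w) *
          ENNReal.ofReal (∑ i, (a w i - if i = j then t else 0) ^ 2)
        + ENNReal.ofReal (t ^ 2 / m ^ 2) *
          ∑ j, ∑ l, ENNReal.ofReal (shiftRatio (v j) w ^ 2 / shiftRatio (v l) w) := by
    intro w
    have h := ENNReal.ofReal_le_ofReal (sum_mul_spike_loss_lower_bound hm t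
      (fun j => shiftRatio (v j) w) (a w) fun j => hpos _ _)
    have hsum : ∀ j, 0 ≤ ∑ l, shiftRatio (v j) w ^ 2 / shiftRatio (v l) w := fun j =>
      Finset.sum_nonneg fun l _ => div_nonneg (sq_nonneg _) (hpos _ _).le
    have hl : ∀ j, 0 ≤ ∑ i, (a w i - if i = j then t else 0) ^ 2 := fun j =>
      Finset.sum_nonneg fun i _ => sq_nonneg _
    rw [ENNReal.ofReal_mul (sq_nonneg _), ENNReal.ofReal_add
      (Finset.sum_nonneg fun j _ => mul_nonneg (hpos _ _).le (hl j))
      (mul_nonneg (by positivity) (Finset.sum_nonneg fun j _ => hsum j)),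
      ENNReal.ofReal_mul (by positivity),
      ENNReal.ofReal_sum_of_nonneg (fun j _ => (hpos (v j) w).le),
      ENNReal.ofReal_sum_of_nonneg (fun j _ => mul_nonneg (hpos _ _).le (hl j)),
      ENNReal.ofReal_sum_of_nonneg (fun j _ => hsum j)] at h
    refine h.trans_eq ?_
    congr 1
    · exact Finset.sum_congr rfl fun j _ => ENNReal.ofReal_mul (hpos _ _).le
    · congr 1
      exact Finset.sum_congr rfl fun j _ => ENNReal.ofReal_sum_of_nonneg fun l _ =>
        div_nonneg (sq_nonneg _) (hpos _ _).le
  have hle := lintegral_mono (μ := γ) key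
  rw [lintegral_const_mul _ (by fun_prop), lintegral_finsetSum _ (by fun_prop),
    lintegral_add_left (by fun_prop), lintegral_finsetSum _ (by fun_prop),
    lintegral_const_mul _ (by fun_prop), lintegral_finsetSum _ (by fun_prop)] at hle
  simp only [hγ, lintegral_shiftRatio] at hle
  simp only [← hγ] at hle
  rw [ENNReal.ofReal_mul (sq_nonneg _), ENNReal.ofReal_natCast]
  simp only [Finset.sum_const, Finset.card_univ, Fintype.card_fin, nsmul_eq_mul, mul_one] at hle
  refine hle.trans_eq ?_
  congr 1
  · exact Finset.sum_congr rfl fun j _ => (lintegral_add_stdGaussian (v j) (hloss j)).symm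
  · congr 1
    refine Finset.sum_congr rfl fun j _ => ?_
    rw [lintegral_finsetSum _ (by fun_prop)]
    exact Finset.sum_congr rfl fun l _ => lintegral_shiftRatio_sq_div (v j) (v l)

lemma inv_sqrt_one_sub_le_exp {x : ℝ} (h0 : 0 ≤ x) (h1 : x ≤ 1 / 2) :
    (√(1 - x))⁻¹ ≤ Real.exp x := by
  have hpos : 0 < √(1 - x) := Real.sqrt_pos.mpr (by linarith)
  rw [inv_le_iff_one_le_mul₀ hpos, ← Real.sqrt_sq (Real.exp_pos x).le,
    ← Real.sqrt_mul (sq_nonneg _), Real.one_le_sqrt, ← Real.exp_nat_mul]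
  have h2 := Real.add_one_le_exp (2 * x)
  push_cast
  nlinarith

lemma lintegral_exp_sq_gaussianReal_le {v : ℝ≥0} (hv : v ≠ 0) {s : ℝ} (hs : 0 ≤ s)
    (hsv : 2 * s * v ≤ 1 / 2) :
    ∫⁻ x, ENNReal.ofReal (Real.exp (s * x ^ 2)) ∂gaussianReal 0 v
      ≤ ENNReal.ofReal (Real.exp (2 * s * v)) := by
  have hv0 : (0 : ℝ) < v := NNReal.coe_pos.mpr (pos_iff_ne_zero.mpr hv)
  have hd : 0 < 1 - 2 * s * v := by linarith
  set d : ℝ≥0 := ⟨1 - 2 * s * v, hd.le⟩ with hddef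
  have hdc : (d : ℝ) = 1 - 2 * s * v := rfl
  have hd0 : d ≠ 0 := fun h => hd.ne' (by rw [← hdc, h]; rfl)
  have hw : v / d ≠ 0 := div_ne_zero hv hd0
  have hpdf : ∀ x, gaussianPDF 0 v x * ENNReal.ofReal (Real.exp (s * x ^ 2))
      = ENNReal.ofReal (√(1 - 2 * s * v))⁻¹ * gaussianPDF 0 (v / d) x := by
    intro x
    simp only [gaussianPDF]
    rw [← ENNReal.ofReal_mul (gaussianPDFReal_nonneg _ _ _), ← ENNReal.ofReal_mul (by positivity)]
    congr 1
    simp only [gaussianPDFReal, NNReal.coe_div, hdc, sub_zero]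
    rw [mul_assoc, ← Real.exp_add, ← mul_assoc]
    congr 1
    · rw [← mul_inv, ← Real.sqrt_mul hd.le]
      congr 2
      field_simp
      rw [div_self (by nlinarith)]
    · congr 1
      field_simp
      ring
  rw [gaussianReal_of_var_ne_zero _ hv,
    lintegral_withDensity_eq_lintegral_mul _ (measurable_gaussianPDF _ _) (by fun_prop)]
  simp only [Pi.mul_apply, hpdf]
  rw [lintegral_const_mul _ (measurable_gaussianPDF _ _), lintegral_gaussianPDF_eq_one _ hw,
    mul_one]
  exact ENNReal.ofReal_le_ofReal (inv_sqrt_one_sub_le_exp (by positivity) hsv)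

/-- Law of the Gaussian design matrix. -/
def designLaw (n p : ℕ) : Measure (Fin n → Fin p → ℝ) :=
  Measure.pi fun _ : Fin n => Measure.pi fun _ : Fin p => gaussianReal 0 (n : ℝ≥0)⁻¹

instance (n p : ℕ) : IsProbabilityMeasure (designLaw n p) := by
  unfold designLaw
  infer_instance

lemma lintegral_exp_sq_column_le {n p : ℕ} (hn : 0 < n) {s : ℝ} (hs : 0 ≤ s) (hs' : s ≤ 1 / 4)
    (l : Fin p) :
    ∫⁻ X, ENNReal.ofReal (Real.exp (s * ∑ i, X i l ^ 2)) ∂designLaw n p ≤ 2 := by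
  have hn' : (1 : ℝ) ≤ n := by exact_mod_cast hn
  have hv : ((n : ℝ≥0)⁻¹) ≠ 0 := inv_ne_zero (by exact_mod_cast hn.ne')
  have hsv : 2 * s * ((n : ℝ≥0)⁻¹ : ℝ≥0) ≤ 1 / 2 := by
    push_cast
    have : (n : ℝ)⁻¹ ≤ 1 := inv_le_one_of_one_le₀ hn'
    nlinarith [inv_nonneg.mpr (zero_le_one.trans hn')]
  have hprod : ∀ X : Fin n → Fin p → ℝ, ENNReal.ofReal (Real.exp (s * ∑ i, X i l ^ 2))
      = ∏ i, ENNReal.ofReal (Real.exp (s * X i l ^ 2)) := by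
    intro X
    rw [Finset.mul_sum, Real.exp_sum, ENNReal.ofReal_prod_of_nonneg fun i _ => (Real.exp_pos _).le]
  simp only [hprod, designLaw]
  rw [lintegral_pi_prod_eq_prod
    (fun _ : Fin n => Measure.pi fun _ : Fin p => gaussianReal 0 (n : ℝ≥0)⁻¹)
    (f := fun _ x => ENNReal.ofReal (Real.exp (s * x l ^ 2))) (fun i => by fun_prop)]
  have hrow : ∫⁻ x : Fin p → ℝ, ENNReal.ofReal (Real.exp (s * x l ^ 2))
        ∂(Measure.pi fun _ : Fin p => gaussianReal 0 (n : ℝ≥0)⁻¹)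
      ≤ ENNReal.ofReal (Real.exp (2 * s * ((n : ℝ≥0)⁻¹ : ℝ≥0))) := by
    rw [(measurePreserving_eval (fun _ : Fin p => gaussianReal 0 (n : ℝ≥0)⁻¹) l).lintegral_comp
      (f := fun x => ENNReal.ofReal (Real.exp (s * x ^ 2))) (by fun_prop)]
    exact lintegral_exp_sq_gaussianReal_le hv hs hsv
  refine (Finset.prod_le_prod' fun i _ => hrow).trans ?_
  rw [Finset.prod_const, ← ENNReal.ofReal_pow (Real.exp_pos _).le, ← Real.exp_nat_mul,
    Finset.card_univ, Fintype.card_fin, ← ENNReal.ofReal_ofNat]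
  refine ENNReal.ofReal_le_ofReal ?_
  have he : (n : ℝ) * (2 * s * ((n : ℝ≥0)⁻¹ : ℝ≥0)) = 2 * s := by
    push_cast
    field_simp
  rw [he, ← Real.le_log_iff_exp_le two_pos]
  linarith [Real.log_two_gt_d9]

lemma lintegral_exp_sq_column_sub_le {n p : ℕ} (hn : 0 < n) {c : ℝ} (hc : 0 ≤ c)
    (hc' : c ≤ 1 / 16) (l l' : Fin p) :
    ∫⁻ X, ENNReal.ofReal (Real.exp (c * ∑ i, (X i l - X i l') ^ 2)) ∂designLaw n p ≤ 2 := by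
  have hpt : ∀ X : Fin n → Fin p → ℝ,
      ENNReal.ofReal (Real.exp (c * ∑ i, (X i l - X i l') ^ 2))
        ≤ ENNReal.ofReal (1 / 2) * (ENNReal.ofReal (Real.exp (4 * c * ∑ i, X i l ^ 2))
          + ENNReal.ofReal (Real.exp (4 * c * ∑ i, X i l' ^ 2))) := by
    intro X
    rw [← ENNReal.ofReal_add (Real.exp_pos _).le (Real.exp_pos _).le,
      ← ENNReal.ofReal_mul (by norm_num)]
    refine ENNReal.ofReal_le_ofReal ?_
    set A := ∑ i, X i l ^ 2
    set B := ∑ i, X i l' ^ 2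
    have h1 : ∑ i, (X i l - X i l') ^ 2 ≤ 2 * A + 2 * B := by
      rw [Finset.mul_sum, Finset.mul_sum, ← Finset.sum_add_distrib]
      exact Finset.sum_le_sum fun i _ => by nlinarith [sq_nonneg (X i l + X i l')]
    have h2 : Real.exp (c * ∑ i, (X i l - X i l') ^ 2)
        ≤ Real.exp (2 * c * A) * Real.exp (2 * c * B) := by
      rw [← Real.exp_add]
      refine Real.exp_le_exp.mpr ?_
      nlinarith
    have h3 : ∀ D : ℝ, Real.exp (4 * c * D) = Real.exp (2 * c * D) ^ 2 := fun D => by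
      rw [← Real.exp_nat_mul]
      congr 1
      push_cast
      ring
    rw [h3, h3]
    nlinarith [sq_nonneg (Real.exp (2 * c * A) - Real.exp (2 * c * B))]
  refine (lintegral_mono hpt).trans ?_
  rw [lintegral_const_mul _ (by fun_prop), lintegral_add_left (by fun_prop)]
  have h := fun l : Fin p => lintegral_exp_sq_column_le (n := n) (p := p) hn
    (s := 4 * c) (by positivity) (by linarith) l
  calc _ ≤ ENNReal.ofReal (1 / 2) * (2 + 2) := by gcongr <;> exact h _
    _ = 2 := by
      rw [← ENNReal.ofReal_ofNat, ← ENNReal.ofReal_add (by norm_num) (by norm_num),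
        ← ENNReal.ofReal_mul (by norm_num)]
      norm_num

lemma sum_sum_update {κ ι M : Type*} [Fintype κ] [DecidableEq κ] [Fintype ι]
    [AddCommMonoid M] (f : (κ → ι) → M) (b : κ) :
    ∑ J, ∑ j, f (Function.update J b j) = Fintype.card ι • ∑ J, f J := by
  have hinv : Function.Involutive fun x : (κ → ι) × ι => (Function.update x.1 b x.2, x.1 b) := by
    intro x
    simp
  calc ∑ J, ∑ j, f (Function.update J b j)
      = ∑ x : (κ → ι) × ι, f (Function.update x.1 b x.2) :=
        (Fintype.sum_prod_type' fun J j => f (Function.update J b j)).symm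
    _ = ∑ x : (κ → ι) × ι, f x.1 :=
        Equiv.sum_comp hinv.toPerm fun x => f x.1
    _ = Fintype.card ι • ∑ J, f J := by
      rw [Fintype.sum_prod_type]
      simp [Finset.smul_sum]

/-- The vector with one entry `t` in each block `b`, at the position selected by `J b`. -/
def blockSpike {k m p : ℕ} (φ : Fin k → Fin m → Fin p) (t : ℝ) (J : Fin k → Fin m) :
    Fin p → ℝ :=
  fun l => if l ∈ Finset.univ.image (fun b => φ b (J b)) then t else 0

section BlockSpike

variable {k m p : ℕ} {φ : Fin k → Fin m → Fin p}

lemma blockSpike_mem_Theta (t : ℝ) (J : Fin k → Fin m) : blockSpike φ t J ∈ Theta p k t := by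
  have hcard : (Finset.univ.image (fun b => φ b (J b))).card ≤ k :=
    Finset.card_image_le.trans_eq (by simp)
  constructor
  · refine (Finset.card_le_card fun l hl => ?_).trans hcard
    by_contra h
    exact (Finset.mem_filter.mp hl).2 (if_neg h)
  · have : ∀ l, blockSpike φ t J l ^ 2
        = if l ∈ Finset.univ.image (fun b => φ b (J b)) then t ^ 2 else 0 := by
      intro l
      unfold blockSpike
      split_ifs <;> simp
    simp only [this, Finset.sum_ite_mem, Finset.univ_inter, Finset.sum_const, nsmul_eq_mul]
    gcongr

lemma blockSpike_apply (hφ : Function.Injective2 φ) (t : ℝ) (J : Fin k → Fin m) (b : Fin k)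
    (j : Fin m) : blockSpike φ t J (φ b j) = if j = J b then t else 0 := by
  unfold blockSpike
  congr 1
  simp only [Finset.mem_image, Finset.mem_univ, true_and, eq_iff_iff]
  constructor
  · rintro ⟨b', h⟩
    obtain ⟨rfl, rfl⟩ := hφ h
    rfl
  · rintro rfl
    exact ⟨b, rfl⟩

lemma sum_mul_blockSpike (hφ : Function.Injective2 φ) (t : ℝ) (J : Fin k → Fin m)
    (x : Fin p → ℝ) : ∑ l, x l * blockSpike φ t J l = ∑ b, x (φ b (J b)) * t := by
  simp only [blockSpike, mul_ite, mul_zero, Finset.sum_ite_mem, Finset.univ_inter]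
  exact Finset.sum_image fun b _ b' _ h => (hφ h).1

lemma sum_mul_blockSpike_update_sub (hφ : Function.Injective2 φ) (t : ℝ) (J : Fin k → Fin m)
    (b : Fin k) (i j : Fin m) (x : Fin p → ℝ) :
    ∑ l, x l * blockSpike φ t (Function.update J b i) l
        - ∑ l, x l * blockSpike φ t (Function.update J b j) l
      = t * (x (φ b i) - x (φ b j)) := by
  rw [sum_mul_blockSpike hφ, sum_mul_blockSpike hφ, ← Finset.sum_sub_distrib,
    Finset.sum_eq_single b]
  · simp
    ring
  · intro b' _ hb'
    simp [Function.update_of_ne hb']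
  · simp

/-- Risk at `blockSpike φ t J` incurred on the coordinates of block `b`. -/
def blockRisk (n : ℕ) (σ : ℝ) (est : (Fin n → Fin p → ℝ) × (Fin n → ℝ) → Fin p → ℝ)
    (φ : Fin k → Fin m → Fin p) (t : ℝ) (b : Fin k) (J : Fin k → Fin m) : ℝ≥0∞ :=
  ∫⁻ X, ∫⁻ z, ENNReal.ofReal (∑ i,
      (est (X, fun r => (∑ l, X r l * blockSpike φ t J l) + σ * z r) (φ b i)
        - if i = J b then t else 0) ^ 2)
    ∂(Measure.pi fun _ : Fin n => gaussianReal 0 1) ∂designLaw n p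

variable {n : ℕ} {σ : ℝ} {est : (Fin n → Fin p → ℝ) × (Fin n → ℝ) → Fin p → ℝ}

lemma measurable_blockRisk_integrand (hest : Measurable est) (β : Fin p → ℝ) (a : Fin m → ℝ)
    (b : Fin k) :
    Measurable fun ω : (Fin n → Fin p → ℝ) × (Fin n → ℝ) => ENNReal.ofReal (∑ i,
      (est (ω.1, fun r => (∑ l, ω.1 r l * β l) + σ * ω.2 r) (φ b i) - a i) ^ 2) := by
  have h : ∀ l, Measurable fun ω : (Fin n → Fin p → ℝ) × (Fin n → ℝ) =>
      est (ω.1, fun r => (∑ l, ω.1 r l * β l) + σ * ω.2 r) l := fun l =>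
    (measurable_pi_apply l).comp (hest.comp (by fun_prop))
  fun_prop

lemma sum_blockRisk_le_risk (hφ : Function.Injective2 φ) (hest : Measurable est) (t : ℝ)
    (J : Fin k → Fin m) :
    ∑ b, blockRisk n σ est φ t b J ≤ risk n p σ est (blockSpike φ t J) := by
  have hmeas := fun b => measurable_blockRisk_integrand (σ := σ) (φ := φ) hest (blockSpike φ t J)
    (fun i => if i = J b then t else 0) b
  have hb : ∀ b, blockRisk n σ est φ t b J = ∫⁻ ω, ENNReal.ofReal (∑ i,
      (est (ω.1, fun r => (∑ l, ω.1 r l * blockSpike φ t J l) + σ * ω.2 r) (φ b i)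
        - if i = J b then t else 0) ^ 2) ∂model n p := fun b =>
    (lintegral_prod (μ := designLaw n p) _ (hmeas b).aemeasurable).symm
  simp only [hb]
  rw [← lintegral_finsetSum _ fun b _ => hmeas b]
  refine lintegral_mono fun ω => ?_
  simp only
  rw [← ENNReal.ofReal_sum_of_nonneg fun b _ => Finset.sum_nonneg fun i _ => sq_nonneg _]
  refine ENNReal.ofReal_le_ofReal ?_
  simp only [← blockSpike_apply hφ t J]
  rw [← Fintype.sum_prod_type' fun b i =>
    (est (ω.1, fun r => (∑ l, ω.1 r l * blockSpike φ t J l) + σ * ω.2 r) (φ b i)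
      - blockSpike φ t J (φ b i)) ^ 2]
  have hinj : Function.Injective fun x : Fin k × Fin m => φ x.1 x.2 := fun x y h =>
    Prod.ext_iff.mpr (hφ h)
  refine (Finset.sum_map Finset.univ ⟨_, hinj⟩ fun l =>
    (est (ω.1, fun r => (∑ l, ω.1 r l * blockSpike φ t J l) + σ * ω.2 r) l
      - blockSpike φ t J l) ^ 2).symm.trans_le ?_
  exact Finset.sum_le_sum_of_subset_of_nonneg (Finset.subset_univ _) fun _ _ _ => sq_nonneg _

lemma blockRisk_average_lower_bound (hn : 0 < n) (hm : 0 < m) (hφ : Function.Injective2 φ)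
    (hest : Measurable est) {t : ℝ} (hσ : 0 < σ) (ht : (t / σ) ^ 2 ≤ 1 / 16)
    (J : Fin k → Fin m) (b : Fin k) :
    ENNReal.ofReal (t ^ 2 * m) ≤
      ∑ j, blockRisk n σ est φ t b (Function.update J b j) + ENNReal.ofReal (2 * t ^ 2) := by
  have hm' : (0 : ℝ) < m := Nat.cast_pos.mpr hm
  set γ := Measure.pi fun _ : Fin n => gaussianReal 0 1 with hγ
  have key : ∀ X : Fin n → Fin p → ℝ, ENNReal.ofReal (t ^ 2 * m) ≤
      ∑ j, ∫⁻ z, ENNReal.ofReal (∑ i,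
        (est (X, fun r => (∑ l, X r l * blockSpike φ t (Function.update J b j) l) + σ * z r)
          (φ b i) - if i = j then t else 0) ^ 2) ∂γ
      + ENNReal.ofReal (t ^ 2 / m ^ 2) * ∑ j, ∑ l, ENNReal.ofReal
          (Real.exp ((t / σ) ^ 2 * ∑ r, (X r (φ b j) - X r (φ b l)) ^ 2)) := by
    intro X
    have h := spike_bayes_risk_lower_bound hm t
      (fun j r => (∑ l, X r l * blockSpike φ t (Function.update J b j) l) / σ)
      (fun w i => est (X, fun r => σ * w r) (φ b i))
      (measurable_pi_lambda _ fun i => (measurable_pi_apply _).comp (hest.comp (by fun_prop)))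
    refine h.trans_eq ?_
    congr 1
    · simp only [Pi.add_apply, mul_add, mul_div_cancel₀ _ hσ.ne', hγ]
    · congr 1
      refine Finset.sum_congr rfl fun j _ => Finset.sum_congr rfl fun l _ => ?_
      congr 2
      rw [Finset.mul_sum]
      refine Finset.sum_congr rfl fun r _ => ?_
      rw [← sub_div, sum_mul_blockSpike_update_sub hφ]
      ring
  have hmeas : ∀ j, Measurable fun X : Fin n → Fin p → ℝ => ∫⁻ z, ENNReal.ofReal (∑ i,
        (est (X, fun r => (∑ l, X r l * blockSpike φ t (Function.update J b j) l) + σ * z r)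
          (φ b i) - if i = j then t else 0) ^ 2) ∂γ := fun j =>
    (measurable_blockRisk_integrand (σ := σ) (φ := φ) hest
      (blockSpike φ t (Function.update J b j)) (fun i => if i = j then t else 0)
      b).lintegral_prod_right'
  have hle := lintegral_mono (μ := designLaw n p) key
  rw [lintegral_const, measure_univ, mul_one,
    lintegral_add_left (Finset.measurable_fun_sum _ fun j _ => hmeas j),
    lintegral_finsetSum _ fun j _ => hmeas j, lintegral_const_mul _ (by fun_prop),
    lintegral_finsetSum _ (by fun_prop)] at hle
  refine hle.trans (add_le_add (le_of_eq ?_) ?_)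
  · simp only [blockRisk, Function.update_self, hγ]
  · calc _ ≤ ENNReal.ofReal (t ^ 2 / m ^ 2) * ∑ _j : Fin m, ∑ _l : Fin m, 2 := by
          gcongr with j _
          rw [lintegral_finsetSum _ (by fun_prop)]
          exact Finset.sum_le_sum fun l _ =>
            lintegral_exp_sq_column_sub_le hn (sq_nonneg _) ht _ _
      _ = ENNReal.ofReal (2 * t ^ 2) := by
          simp only [Finset.sum_const, Finset.card_univ, Fintype.card_fin, nsmul_eq_mul]
          rw [← ENNReal.ofReal_natCast, ← ENNReal.ofReal_ofNat,
            ← ENNReal.ofReal_mul hm'.le, ← ENNReal.ofReal_mul hm'.le,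
            ← ENNReal.ofReal_mul (by positivity)]
          congr 1
          field_simp

lemma iSup_risk_lower_bound (hn : 0 < n) (hm : 0 < m) (hφ : Function.Injective2 φ)
    (hest : Measurable est) {t : ℝ} (hσ : 0 < σ) (ht : (t / σ) ^ 2 ≤ 1 / 16) :
    ENNReal.ofReal (k * t ^ 2 * (1 - 2 / m)) ≤ ⨆ β ∈ Theta p k t, risk n p σ est β := by
  have : NeZero m := ⟨hm.ne'⟩
  have hm' : (0 : ℝ) < m := Nat.cast_pos.mpr hm
  set S := ⨆ β ∈ Theta p k t, risk n p σ est β with hS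
  have hrisk : ∀ J, ∑ b, blockRisk n σ est φ t b J ≤ S := fun J =>
    (sum_blockRisk_le_risk hφ hest t J).trans
      (le_iSup₂ (f := fun β (_ : β ∈ Theta p k t) => risk n p σ est β) _
        (blockSpike_mem_Theta t J))
  set N := Fintype.card (Fin k → Fin m) with hN
  have hN' : (0 : ℝ) < N := Nat.cast_pos.mpr Fintype.card_pos
  have hsum : ∑ _b : Fin k, ∑ _J : Fin k → Fin m, ENNReal.ofReal (t ^ 2 * m)
      ≤ m * (N * S) + ∑ _b : Fin k, ∑ _J : Fin k → Fin m, ENNReal.ofReal (2 * t ^ 2) := by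
    calc _ ≤ ∑ b, ∑ J, (∑ j, blockRisk n σ est φ t b (Function.update J b j)
            + ENNReal.ofReal (2 * t ^ 2)) :=
          Finset.sum_le_sum fun b _ => Finset.sum_le_sum fun J _ =>
            blockRisk_average_lower_bound hn hm hφ hest hσ ht J b
      _ = m * ∑ J, ∑ b, blockRisk n σ est φ t b J
            + ∑ _b : Fin k, ∑ _J : Fin k → Fin m, ENNReal.ofReal (2 * t ^ 2) := by
          simp only [Finset.sum_add_distrib, sum_sum_update, ← Finset.smul_sum]
          rw [Finset.sum_comm, nsmul_eq_mul, Fintype.card_fin]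
      _ ≤ _ := by
          gcongr
          refine (Finset.sum_le_sum fun J _ => hrisk J).trans_eq ?_
          rw [Finset.sum_const, Finset.card_univ, nsmul_eq_mul]
  rcases eq_or_ne S ⊤ with hST | hST
  · rw [hST]
    exact le_top
  rw [ENNReal.ofReal_le_iff_le_toReal hST]
  rw [← ENNReal.ofReal_toReal hST] at hsum
  have hS0 : 0 ≤ S.toReal := ENNReal.toReal_nonneg
  simp only [Finset.sum_const, Finset.card_univ, Fintype.card_fin, ← hN, nsmul_eq_mul] at hsum
  rw [← ENNReal.ofReal_natCast, ← ENNReal.ofReal_natCast, ← ENNReal.ofReal_natCast,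
    ← ENNReal.ofReal_mul (by positivity), ← ENNReal.ofReal_mul (by positivity),
    ← ENNReal.ofReal_mul (by positivity), ← ENNReal.ofReal_mul (by positivity),
    ← ENNReal.ofReal_mul (by positivity), ← ENNReal.ofReal_mul (by positivity),
    ← ENNReal.ofReal_add (by positivity) (by positivity),
    ENNReal.ofReal_le_ofReal_iff (by positivity)] at hsum
  have h : (m * N) * (k * t ^ 2 * (1 - 2 / m)) ≤ (m * N) * S.toReal := by
    have : (m * N) * (k * t ^ 2 * (1 - 2 / m)) = k * (N * (t ^ 2 * m)) - k * (N * (2 * t ^ 2)) := by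
      field_simp
    linarith
  exact le_of_mul_le_mul_left h (by positivity)

end BlockSpike

lemma exists_injective2_fin {k m p : ℕ} (h : k * m ≤ p) :
    ∃ φ : Fin k → Fin m → Fin p, Function.Injective2 φ :=
  ⟨fun b j => Fin.castLE h (finProdFinEquiv (b, j)), fun _ _ _ _ he =>
    Prod.ext_iff.mp (finProdFinEquiv.injective (Fin.castLE_injective h he))⟩

lemma le_minimaxRisk {n p k : ℕ} (hn : 0 < n) {t σ : ℝ} (hσ : 0 < σ)
    (ht : (t / σ) ^ 2 ≤ 1 / 16) (hk : 0 < k) (hkp : k ≤ p) :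
    ENNReal.ofReal (k * t ^ 2 * (1 - 2 / (p / k : ℕ))) ≤ minimaxRisk n p k t σ := by
  obtain ⟨φ, hφ⟩ := exists_injective2_fin (Nat.mul_div_le p k)
  exact le_iInf₂ fun est hest =>
    iSup_risk_lower_bound hn (Nat.div_pos hkp hk) hφ hest hσ ht

lemma minimaxRisk_le (n p k : ℕ) (t σ : ℝ) :
    minimaxRisk n p k t σ ≤ ENNReal.ofReal (k * t ^ 2) := by
  have hprob : IsProbabilityMeasure (model n p) := by
    unfold model
    infer_instance
  refine (iInf₂_le (fun _ _ => 0) measurable_const).trans (iSup₂_le fun β hβ => ?_)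
  simp only [risk, zero_sub, even_two, Even.neg_pow, lintegral_const, measure_univ, mul_one]
  exact ENNReal.ofReal_le_ofReal hβ.2

/-- **Theorem 2, Regime I (low SNR).** If `k/p → 0`, `(k log p)/n → 0` and `μ = τ/σ → 0`,
then the minimax risk satisfies `R(Θ(k,τ),σ) = k τ² (1 + o(1))`. -/
theorem regimeI_first_order_minimax
    (k p : ℕ → ℕ) (τ σ : ℕ → ℝ)
    (hk : ∀ n, 0 < k n) (hkp : ∀ n, k n ≤ p n)
    (hτ : ∀ n, 0 < τ n) (hσ : ∀ n, 0 < σ n)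
    (hkp0 : Tendsto (fun n => (k n : ℝ) / p n) atTop (nhds 0))
    (hklogp : Tendsto (fun n => (k n : ℝ) * Real.log (p n) / n) atTop (nhds 0))
    (hμ : Tendsto (fun n => τ n / σ n) atTop (nhds 0)) :
    Tendsto (fun n => (minimaxRisk n (p n) (k n) (τ n) (σ n)).toReal / (k n * τ n ^ 2))
      atTop (nhds 1) := by
  have hden : ∀ n, 0 < (k n : ℝ) * τ n ^ 2 := fun n =>
    mul_pos (Nat.cast_pos.mpr (hk n)) (pow_pos (hτ n) 2)
  have hdiv : Tendsto (fun n => p n / k n) atTop atTop := by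
    refine tendsto_atTop.mpr fun M => ?_
    have hpos : (0 : ℝ) < 1 / (M + 1) := by positivity
    filter_upwards [hkp0.eventually (gt_mem_nhds hpos)] with n hn
    have hp : (0 : ℝ) < p n := Nat.cast_pos.mpr ((hk n).trans_le (hkp n))
    rw [div_lt_div_iff₀ hp (by positivity), one_mul] at hn
    rw [Nat.le_div_iff_mul_le (hk n)]
    have h : k n * (M + 1) < p n := by exact_mod_cast hn
    nlinarith
  have hlim : Tendsto (fun n => 1 - 2 / ((p n / k n : ℕ) : ℝ)) atTop (nhds 1) := by
    have h := (tendsto_natCast_atTop_atTop (R := ℝ)).comp hdiv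
    simpa using tendsto_const_nhds.sub (h.const_div_atTop 2)
  have hsq : Tendsto (fun n => (τ n / σ n) ^ 2) atTop (nhds 0) := by
    simpa using hμ.pow 2
  refine tendsto_of_tendsto_of_tendsto_of_le_of_le' hlim tendsto_const_nhds ?_ ?_
  · filter_upwards [eventually_gt_atTop 0,
      hsq.eventually (ge_mem_nhds (by norm_num : (0 : ℝ) < 1 / 16))] with n hn hsmall
    rw [le_div_iff₀ (hden n), mul_comm]
    have hfin : minimaxRisk n (p n) (k n) (τ n) (σ n) ≠ ⊤ :=
      ((minimaxRisk_le _ _ _ _ _).trans_lt ENNReal.ofReal_lt_top).ne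
    exact (ENNReal.ofReal_le_iff_le_toReal hfin).mp
      (le_minimaxRisk hn (hσ n) hsmall (hk n) (hkp n))
  · filter_upwards with n
    rw [div_le_one (hden n)]
    exact ENNReal.toReal_le_of_le_ofReal (hden n).le (minimaxRisk_le _ _ _ _ _)
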